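/- arXiv:2110.12931 — 3 statements merged into one kernel-verified Lean document; each statement's English description precedes it below -/
import Mathlib

section
/- Let 0 < α < 1, h ≥ 0, T > 0, let f : [0,T] × ℝ × ℝ → ℝ be continuous, let g : [0,T] → [−h,T] be continuous with g(t) ≤ t for all t ∈ [0,T], and let φ : [−h,0] → ℝ be continuous. Assume there is a constant L > 0 such that |f(t,υ₁,ϑ₁) − f(t,υ₂,ϑ₂)| ≤ L(|υ₁ − υ₂| + |ϑ₁ − ϑ₂|) for all υ₁,υ₂,ϑ₁,ϑ₂ ∈ ℝ and t ∈ [0,T]. Then there exists a unique continuous function υ : [−h,T] → ℝ such that υ(t) = φ(t) for t ∈ [−h,0] and υ(t) = φ(0) + (1/Γ(α)) ∫₀ᵗ (t−s)^{α−1} f(s, υ(s), υ(g(s))) ds for t ∈ [0,T]. -/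
open Real Set

/-- `υ` solves the integral form of the Caputo fractional delay problem
`ᶜD^α υ(t) = f(t, υ(t), υ(g(t)))` on `[0,T]` with initial data `φ` on `[-h,0]`. -/
def SolvesFDDE (α h T : ℝ) (f : ℝ → ℝ → ℝ → ℝ) (g φ υ : ℝ → ℝ) : Prop :=
  ContinuousOn υ (Set.Icc (-h) T) ∧
  (∀ t ∈ Set.Icc (-h) 0, υ t = φ t) ∧
  (∀ t ∈ Set.Icc 0 T, υ t = φ 0 +
    (1 / Real.Gamma α) * ∫ s in (0:ℝ)..t, (t - s) ^ (α - 1) * f s (υ s) (υ (g s)))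

open MeasureTheory intervalIntegral

theorem intervalIntegrable_sub_rpow_mul {α t : ℝ} (hα : 0 < α) {u : ℝ → ℝ} (hu : Continuous u) :
    IntervalIntegrable (fun s => (t - s) ^ (α - 1) * u s) volume 0 t := by
  have h : IntervalIntegrable (fun s : ℝ => s ^ (α - 1)) volume t 0 :=
    intervalIntegrable_rpow' (by linarith)
  have h' := h.comp_sub_left t
  simp only [sub_self, sub_zero] at h'
  exact h'.mul_continuousOn hu.continuousOn

theorem integral_sub_rpow_mul_eq {α t : ℝ} (hα : 0 < α) (ht : 0 ≤ t) (u : ℝ → ℝ) :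
    ∫ s in (0:ℝ)..t, (t - s) ^ (α - 1) * u s =
      t ^ α * ∫ x in (0:ℝ)..1, (1 - x) ^ (α - 1) * u (t * x) := by
  rcases ht.eq_or_lt with rfl | ht
  · simp [Real.zero_rpow hα.ne']
  have h := smul_integral_comp_mul_left (a := 0) (b := 1)
    (fun s => (t - s) ^ (α - 1) * u s) t
  simp only [mul_zero, mul_one, smul_eq_mul] at h
  rw [← h, ← intervalIntegral.integral_const_mul, ← intervalIntegral.integral_const_mul]
  refine integral_congr fun x hx => ?_
  rw [uIcc_of_le zero_le_one] at hx
  have h1 : t - t * x = t * (1 - x) := by ring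
  have h2 : t ^ α = t * t ^ (α - 1) := by
    rw [Real.rpow_sub_one ht.ne', mul_div_cancel₀ _ ht.ne']
  simp only [h1, h2, Real.mul_rpow ht.le (sub_nonneg.2 hx.2)]
  ring

theorem continuous_integral_sub_rpow_mul {α C : ℝ} (hα : 0 < α) {u : ℝ → ℝ} (hu : Continuous u)
    (hC : ∀ s, |u s| ≤ C) :
    Continuous fun t : ℝ => ∫ s in (0:ℝ)..max t 0, (max t 0 - s) ^ (α - 1) * u s := by
  simp_rw [integral_sub_rpow_mul_eq hα (le_max_right _ 0)]
  refine ((continuous_id.max continuous_const).rpow_const fun _ => .inr hα.le).mul ?_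
  have hint : IntervalIntegrable (fun x : ℝ => (1 - x) ^ (α - 1)) volume 0 1 := by
    simpa using intervalIntegrable_sub_rpow_mul (t := 1) hα (u := fun _ => 1) continuous_const
  refine continuous_of_dominated_interval (bound := fun x => |(1 - x) ^ (α - 1)| * C)
    (fun t => ?_) (fun t => ?_) (hint.abs.mul_const C) ?_
  · exact (by fun_prop : Measurable fun x : ℝ => (1 - x) ^ (α - 1)).aestronglyMeasurable.mul
      (by fun_prop : Continuous fun x : ℝ => u (max t 0 * x)).aestronglyMeasurable
  · refine .of_forall fun x _ => ?_
    rw [norm_mul, Real.norm_eq_abs, Real.norm_eq_abs]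
    gcongr
    exact hC _
  · exact .of_forall fun x _ => by fun_prop

theorem integral_sub_rpow_mul_exp_le {α c t : ℝ} (hα : 0 < α) (hc : 0 < c) (ht : 0 ≤ t) :
    ∫ s in (0:ℝ)..t, (t - s) ^ (α - 1) * exp (c * s) ≤
      exp (c * t) * ((1 / c) ^ α * Real.Gamma α) := by
  have h := integral_comp_sub_left (a := 0) (b := t)
    (fun r : ℝ => r ^ (α - 1) * exp (c * (t - r))) t
  simp only [sub_sub_cancel, sub_zero, sub_self] at h
  have h' : ∀ r : ℝ, r ^ (α - 1) * exp (c * (t - r)) =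
      exp (c * t) * (r ^ (α - 1) * exp (-(c * r))) := fun r => by
    rw [mul_left_comm, ← Real.exp_add]; ring_nf
  simp_rw [h, h', intervalIntegral.integral_const_mul]
  gcongr
  rw [← Real.integral_rpow_mul_exp_neg_mul_Ioi hα hc, integral_of_le ht]
  refine setIntegral_mono_set ?_ ?_ (.of_forall fun x hx => hx.1)
  · refine Integrable.of_integral_ne_zero ?_
    rw [Real.integral_rpow_mul_exp_neg_mul_Ioi hα hc]
    exact mul_ne_zero (by positivity) (Real.Gamma_pos_of_pos hα).ne'
  · filter_upwards [ae_restrict_mem measurableSet_Ioi] with x hx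
    have : (0:ℝ) < x := hx
    simp only [Pi.zero_apply]
    positivity

theorem abs_integral_sub_rpow_mul_le {α c t D : ℝ} (hα : 0 < α) (hc : 0 < c) (ht : 0 ≤ t)
    (hD : 0 ≤ D) {u : ℝ → ℝ} (hu : ∀ s ∈ Icc 0 t, |u s| ≤ D * exp (c * s)) :
    |∫ s in (0:ℝ)..t, (t - s) ^ (α - 1) * u s| ≤
      D * (exp (c * t) * ((1 / c) ^ α * Real.Gamma α)) := by
  refine le_trans ?_ (mul_le_mul_of_nonneg_left (integral_sub_rpow_mul_exp_le hα hc ht) hD)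
  rw [← intervalIntegral.integral_const_mul, ← Real.norm_eq_abs]
  refine norm_integral_le_of_norm_le ht (.of_forall fun s hs => ?_)
    ((intervalIntegrable_sub_rpow_mul hα (by fun_prop)).const_mul D)
  have : 0 ≤ (t - s) ^ (α - 1) := Real.rpow_nonneg (sub_nonneg.2 hs.2) _
  rw [Real.norm_eq_abs, abs_mul, abs_of_nonneg this, mul_left_comm]
  exact mul_le_mul_of_nonneg_left (hu s ⟨hs.1.le, hs.2⟩) this

/-- The delayed right-hand side `f(s, υ(s), υ(g(s)))`, extended constantly from `[0,T]` to `ℝ`. -/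
noncomputable def delayedRHS (T : ℝ) (f : ℝ → ℝ → ℝ → ℝ) (g υ : ℝ → ℝ) (s : ℝ) : ℝ :=
  f (max 0 (min s T)) (υ (max 0 (min s T))) (υ (g (max 0 (min s T))))

/-- The Picard operator of the delay problem, extended continuously from `[-h,T]` to `ℝ`. -/
noncomputable def picardFDDE (α h T : ℝ) (f : ℝ → ℝ → ℝ → ℝ) (g φ υ : ℝ → ℝ) (t : ℝ) : ℝ :=
  φ (max (-h) (min t 0)) + (1 / Real.Gamma α) *
    ∫ s in (0:ℝ)..max t 0, (max t 0 - s) ^ (α - 1) * delayedRHS T f g υ s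

theorem clip_mem {a b : ℝ} (hab : a ≤ b) (s : ℝ) : max a (min s b) ∈ Icc a b :=
  ⟨le_max_left _ _, max_le hab (min_le_right _ _)⟩

theorem clip_eq {a b s : ℝ} (hs : s ∈ Icc a b) : max a (min s b) = s := by
  rw [min_eq_left hs.2, max_eq_right hs.1]

theorem delayedRHS_of_mem {T : ℝ} {f : ℝ → ℝ → ℝ → ℝ} {g υ : ℝ → ℝ} {s : ℝ} (hs : s ∈ Icc 0 T) :
    delayedRHS T f g υ s = f s (υ s) (υ (g s)) := by
  rw [delayedRHS, clip_eq hs]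

theorem continuous_delayedRHS {h T : ℝ} (hh : 0 ≤ h) (hT : 0 ≤ T) {f : ℝ → ℝ → ℝ → ℝ} {g υ : ℝ → ℝ}
    (hf : ContinuousOn (fun p : ℝ × ℝ × ℝ => f p.1 p.2.1 p.2.2)
      (Icc 0 T ×ˢ (univ : Set (ℝ × ℝ))))
    (hg : ContinuousOn g (Icc 0 T)) (hgmem : ∀ t ∈ Icc (0:ℝ) T, g t ∈ Icc (-h) T)
    (hυ : ContinuousOn υ (Icc (-h) T)) : Continuous (delayedRHS T f g υ) := by
  have hp : Continuous fun s : ℝ => max 0 (min s T) := by fun_prop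
  have hpm := fun s => clip_mem hT s
  have h1 : Continuous fun s : ℝ => υ (max 0 (min s T)) :=
    hυ.comp_continuous hp fun s => ⟨by linarith [(hpm s).1], (hpm s).2⟩
  have h2 : Continuous fun s : ℝ => υ (g (max 0 (min s T))) :=
    hυ.comp_continuous (hg.comp_continuous hp hpm) fun s => hgmem _ (hpm s)
  exact hf.comp_continuous (hp.prodMk (h1.prodMk h2)) fun s => ⟨hpm s, mem_univ _⟩

theorem exists_abs_delayedRHS_le {T : ℝ} (hT : 0 ≤ T) {f : ℝ → ℝ → ℝ → ℝ} {g υ : ℝ → ℝ}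
    (hc : Continuous (delayedRHS T f g υ)) : ∃ C, ∀ s, |delayedRHS T f g υ s| ≤ C := by
  obtain ⟨C, hC⟩ := isCompact_Icc.exists_bound_of_continuousOn (s := Icc 0 T) hc.continuousOn
  refine ⟨C, fun s => ?_⟩
  have := hC _ (clip_mem hT s)
  rwa [delayedRHS_of_mem (clip_mem hT s)] at this

theorem continuous_picardFDDE {α h T : ℝ} (hα : 0 < α) (hh : 0 ≤ h) (hT : 0 ≤ T)
    {f : ℝ → ℝ → ℝ → ℝ} {g φ υ : ℝ → ℝ} (hφ : ContinuousOn φ (Icc (-h) 0))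
    (hc : Continuous (delayedRHS T f g υ)) : Continuous (picardFDDE α h T f g φ υ) := by
  obtain ⟨C, hC⟩ := exists_abs_delayedRHS_le hT hc
  exact (hφ.comp_continuous (by fun_prop) (clip_mem (neg_nonpos.2 hh))).add
    (continuous_const.mul (continuous_integral_sub_rpow_mul hα hc hC))

theorem solvesFDDE_iff {α h T : ℝ} (hh : 0 ≤ h) (hT : 0 ≤ T)
    {f : ℝ → ℝ → ℝ → ℝ} {g φ υ : ℝ → ℝ} :
    SolvesFDDE α h T f g φ υ ↔ ContinuousOn υ (Icc (-h) T) ∧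
      EqOn υ (picardFDDE α h T f g φ υ) (Icc (-h) T) := by
  have hneg : ∀ t ∈ Icc (-h) 0, picardFDDE α h T f g φ υ t = φ t := fun t ht => by
    simp [picardFDDE, clip_eq ht, max_eq_right ht.2]
  have hpos : ∀ t ∈ Icc 0 T, picardFDDE α h T f g φ υ t = φ 0 +
      (1 / Real.Gamma α) * ∫ s in (0:ℝ)..t, (t - s) ^ (α - 1) * f s (υ s) (υ (g s)) :=
    fun t ht => by
      rw [picardFDDE, min_eq_right ht.1, max_eq_right (neg_nonpos.2 hh), max_eq_left ht.1]
      congr 2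
      refine integral_congr fun s hs => ?_
      rw [uIcc_of_le ht.1] at hs
      simp only [delayedRHS_of_mem ⟨hs.1, hs.2.trans ht.2⟩]
  refine and_congr_right fun _ => ⟨fun H t ht => ?_, fun H => ⟨fun t ht => ?_, fun t ht => ?_⟩⟩
  · rcases le_total t 0 with h0 | h0
    · rw [hneg t ⟨ht.1, h0⟩, H.1 t ⟨ht.1, h0⟩]
    · rw [hpos t ⟨h0, ht.2⟩, H.2 t ⟨h0, ht.2⟩]
  · rw [H ⟨ht.1, ht.2.trans hT⟩, hneg t ht]
  · rw [H ⟨by linarith [ht.1], ht.2⟩, hpos t ht]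

theorem abs_picardFDDE_sub_le {α h T L c C : ℝ} (hα : 0 < α) (hh : 0 ≤ h)
    (hL : 0 ≤ L) (hc : 0 < c) (hC : 0 ≤ C) {f : ℝ → ℝ → ℝ → ℝ} {g φ υ₁ υ₂ : ℝ → ℝ}
    (hgmem : ∀ t ∈ Icc (0:ℝ) T, g t ∈ Icc (-h) T) (hgle : ∀ t ∈ Icc (0:ℝ) T, g t ≤ t)
    (hLip : ∀ t ∈ Icc (0:ℝ) T, ∀ υ₁ υ₂ ϑ₁ ϑ₂ : ℝ,
      |f t υ₁ ϑ₁ - f t υ₂ ϑ₂| ≤ L * (|υ₁ - υ₂| + |ϑ₁ - ϑ₂|))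
    (h₁ : Continuous (delayedRHS T f g υ₁)) (h₂ : Continuous (delayedRHS T f g υ₂))
    (hυ : ∀ t ∈ Icc (-h) T, |υ₁ t - υ₂ t| ≤ C * exp (c * t)) {t : ℝ} (ht : t ∈ Icc (-h) T) :
    |picardFDDE α h T f g φ υ₁ t - picardFDDE α h T f g φ υ₂ t| ≤
      2 * L * (1 / c) ^ α * C * exp (c * t) := by
  rcases le_total t 0 with h0 | h0
  · simp only [picardFDDE, max_eq_right h0, integral_same, sub_self, abs_zero]
    positivity
  have hΓ := Real.Gamma_pos_of_pos hα
  have key : ∀ s ∈ Icc 0 t, |delayedRHS T f g υ₁ s - delayedRHS T f g υ₂ s| ≤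
      2 * L * C * exp (c * s) := fun s hs => by
    have hs' : s ∈ Icc 0 T := ⟨hs.1, hs.2.trans ht.2⟩
    rw [delayedRHS_of_mem hs', delayedRHS_of_mem hs']
    have e1 := hυ s ⟨by linarith [hs.1], hs'.2⟩
    have e2 : |υ₁ (g s) - υ₂ (g s)| ≤ C * exp (c * s) := by
      refine (hυ _ (hgmem s hs')).trans ?_
      gcongr
      exact hgle s hs'
    calc _ ≤ L * (|υ₁ s - υ₂ s| + |υ₁ (g s) - υ₂ (g s)|) := hLip s hs' _ _ _ _
      _ ≤ L * (C * exp (c * s) + C * exp (c * s)) := by gcongr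
      _ = _ := by ring
  have main := abs_integral_sub_rpow_mul_le hα hc h0 (by positivity) key
  simp only [picardFDDE, max_eq_left h0]
  rw [add_sub_add_left_eq_sub, ← mul_sub, ← integral_sub (intervalIntegrable_sub_rpow_mul hα h₁)
    (intervalIntegrable_sub_rpow_mul hα h₂), abs_mul, abs_of_pos (by positivity)]
  simp_rw [← mul_sub]
  calc _ ≤ 1 / Real.Gamma α * (2 * L * C * (exp (c * t) * ((1 / c) ^ α * Real.Gamma α))) := by
        gcongr
    _ = _ := by field_simp

theorem existence_uniqueness_FDDE
    (α h T L : ℝ) (hα0 : 0 < α) (hα1 : α < 1) (hh : 0 ≤ h) (hT : 0 < T) (hL : 0 < L)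
    (f : ℝ → ℝ → ℝ → ℝ) (g φ : ℝ → ℝ)
    (hf : ContinuousOn (fun p : ℝ × ℝ × ℝ => f p.1 p.2.1 p.2.2)
      (Set.Icc 0 T ×ˢ (Set.univ : Set (ℝ × ℝ))))
    (hg : ContinuousOn g (Set.Icc 0 T))
    (hgmem : ∀ t ∈ Set.Icc (0:ℝ) T, g t ∈ Set.Icc (-h) T)
    (hgle : ∀ t ∈ Set.Icc (0:ℝ) T, g t ≤ t)
    (hφ : ContinuousOn φ (Set.Icc (-h) 0))
    (hLip : ∀ t ∈ Set.Icc (0:ℝ) T, ∀ υ₁ υ₂ ϑ₁ ϑ₂ : ℝ,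
      |f t υ₁ ϑ₁ - f t υ₂ ϑ₂| ≤ L * (|υ₁ - υ₂| + |ϑ₁ - ϑ₂|)) :
    ∃ υ : ℝ → ℝ, SolvesFDDE α h T f g φ υ ∧
      ∀ υ' : ℝ → ℝ, SolvesFDDE α h T f g φ υ' → Set.EqOn υ υ' (Set.Icc (-h) T) := by
  have hhT : -h ≤ T := by linarith
  obtain ⟨c, hc, hcα⟩ : ∃ c : ℝ, 0 < c ∧ 2 * L * (1 / c) ^ α = 1 / 2 := by
    refine ⟨(4 * L) ^ (1 / α), by positivity, ?_⟩
    rw [Real.div_rpow zero_le_one (by positivity), ← Real.rpow_mul (by positivity),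
      one_div_mul_cancel hα0.ne', Real.rpow_one, Real.one_rpow]
    field_simp
    norm_num
  -- A weighted function `w` on `[-h,T]` represents `υ(t) = exp (c * t) * w(t)`.
  let E : C(Icc (-h) T, ℝ) → ℝ → ℝ := fun w t => exp (c * t) * IccExtend hhT w t
  have hE : ∀ w, Continuous (E w) := fun w => by
    have : Continuous (IccExtend hhT w) := w.continuous.Icc_extend'
    fun_prop
  have hEapp : ∀ w (t : Icc (-h) T), E w t = exp (c * t) * w t := fun w t => by
    simp only [E, IccExtend_val]
  have hR : ∀ w, Continuous (delayedRHS T f g (E w)) := fun w =>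
    continuous_delayedRHS hh hT.le hf hg hgmem (hE w).continuousOn
  have hP : ∀ w, Continuous (picardFDDE α h T f g φ (E w)) := fun w =>
    continuous_picardFDDE hα0 hh hT.le hφ (hR w)
  let G : C(Icc (-h) T, ℝ) → C(Icc (-h) T, ℝ) := fun w =>
    ⟨fun t => exp (-(c * t)) * picardFDDE α h T f g φ (E w) t, by
      have := hP w
      fun_prop⟩
  have hG : ContractingWith (1 / 2) G := by
    refine ⟨by rw [← NNReal.coe_lt_coe]; norm_num, LipschitzWith.of_dist_le_mul fun w₁ w₂ => ?_⟩
    rw [ContinuousMap.dist_le (by positivity)]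
    intro t
    have hd : ∀ s ∈ Icc (-h) T, |E w₁ s - E w₂ s| ≤ dist w₁ w₂ * exp (c * s) := fun s hs => by
      rw [hEapp w₁ ⟨s, hs⟩, hEapp w₂ ⟨s, hs⟩, ← mul_sub, abs_mul, Real.abs_exp, mul_comm]
      gcongr
      exact ContinuousMap.dist_apply_le_dist (f := w₁) (g := w₂) ⟨s, hs⟩
    have key := abs_picardFDDE_sub_le (φ := φ) hα0 hh hL.le hc dist_nonneg hgmem hgle hLip
      (hR w₁) (hR w₂) hd t.2
    rw [hcα] at key
    simp only [G, ContinuousMap.coe_mk, Real.dist_eq, ← mul_sub, abs_mul, Real.abs_exp]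
    calc _ ≤ exp (-(c * t)) * (1 / 2 * dist w₁ w₂ * exp (c * t)) := by gcongr
      _ = 1 / 2 * dist w₁ w₂ * (exp (-(c * t)) * exp (c * t)) := by ring
      _ = _ := by rw [← Real.exp_add]; simp
  have hfix : ∀ w, G w = w → EqOn (E w) (picardFDDE α h T f g φ (E w)) (Icc (-h) T) :=
    fun w hw t ht => by
      have hwt : exp (-(c * t)) * picardFDDE α h T f g φ (E w) t = w ⟨t, ht⟩ :=
        DFunLike.congr_fun hw ⟨t, ht⟩
      rw [hEapp w ⟨t, ht⟩, ← hwt, ← mul_assoc, ← Real.exp_add]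
      simp
  refine ⟨E (hG.fixedPoint G), (solvesFDDE_iff hh hT.le).2
    ⟨(hE _).continuousOn, hfix _ hG.fixedPoint_isFixedPt⟩, fun υ' hυ' => ?_⟩
  obtain ⟨hcont, heq⟩ := (solvesFDDE_iff hh hT.le).1 hυ'
  let w : C(Icc (-h) T, ℝ) := ⟨fun t => exp (-(c * t)) * υ' t, by
    exact (by fun_prop : Continuous fun t : Icc (-h) T => exp (-(c * t))).mul hcont.domRestrict⟩
  have hw : EqOn (E w) υ' (Icc (-h) T) := fun t ht => by
    rw [hEapp w ⟨t, ht⟩]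
    simp only [w, ContinuousMap.coe_mk, ← mul_assoc, ← Real.exp_add]
    simp
  have hwG : G w = w := by
    ext t
    have hcongr : |picardFDDE α h T f g φ (E w) t - picardFDDE α h T f g φ υ' t| ≤ _ :=
      abs_picardFDDE_sub_le (C := 0) hα0 hh hL.le hc le_rfl hgmem hgle hLip (hR w)
        (continuous_delayedRHS hh hT.le hf hg hgmem hcont) (fun s hs => by simp [hw hs]) t.2
    have : picardFDDE α h T f g φ (E w) t = picardFDDE α h T f g φ υ' t := by
      simpa [sub_eq_zero] using hcongr
    simp only [G, w, ContinuousMap.coe_mk] at this ⊢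
    rw [this, ← heq t.2]
  rw [← hG.fixedPoint_unique hwG]
  exact hw
end

section
/- Let 0 < α < 1, r > 0, T > 0, let f : [0,T] × ℝ × ℝ → ℝ be continuous with |f(t,υ₁,ϑ) − f(t,υ₂,ϑ)| ≤ L|υ₁ − υ₂| for all υ₁,υ₂,ϑ ∈ ℝ, t ∈ [0,T], where L > 0, and let φ : [−r,0] → ℝ be continuous. Then for every S with 0 < S ≤ min(r,T) there exists a unique continuous function υ : [−r,S] → ℝ such that υ(t) = φ(t) for t ∈ [−r,0] and υ(t) = φ(0) + (1/Γ(α)) ∫₀ᵗ (t−s)^{α−1} f(s, υ(s), υ(s−r)) ds for t ∈ [0,S]. (Since 0 ≤ s ≤ S ≤ r implies s − r ∈ [−r,0], the delayed argument υ(s−r) equals the known initial function φ(s−r).) -/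
open Real Set

/-- `υ` solves, on `[-r,S]`, the integral form of the Caputo fractional problem with
constant delay `r`, with initial data `φ` on `[-r,0]`. -/
def SolvesConstDelayOn (α r S : ℝ) (f : ℝ → ℝ → ℝ → ℝ) (φ υ : ℝ → ℝ) : Prop :=
  ContinuousOn υ (Set.Icc (-r) S) ∧
  (∀ t ∈ Set.Icc (-r) 0, υ t = φ t) ∧
  (∀ t ∈ Set.Icc 0 S, υ t = φ 0 +
    (1 / Real.Gamma α) * ∫ s in (0:ℝ)..t, (t - s) ^ (α - 1) * f s (υ s) (υ (s - r)))

open MeasureTheory intervalIntegral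

theorem intervalIntegrable_abel_kernel_mul {α t : ℝ} (hα : 0 < α) {h : ℝ → ℝ}
    (hh : ContinuousOn h (uIcc 0 t)) :
    IntervalIntegrable (fun s => (t - s) ^ (α - 1) * h s) volume 0 t := by
  have h1 : IntervalIntegrable (fun x : ℝ => x ^ (α - 1)) volume t 0 :=
    intervalIntegrable_rpow' (by linarith)
  have h2 := h1.comp_sub_left t
  simp only [sub_self, sub_zero] at h2
  exact h2.mul_continuousOn hh

theorem abel_integral_eq_rpow_mul {α t : ℝ} (hα : 0 < α) (ht : 0 ≤ t) (h : ℝ → ℝ) :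
    ∫ s in (0 : ℝ)..t, (t - s) ^ (α - 1) * h s =
      t ^ α * ∫ x in (0 : ℝ)..1, (1 - x) ^ (α - 1) * h (t * x) := by
  rcases ht.eq_or_lt with rfl | ht
  · simp [zero_rpow hα.ne']
  have h1 := mul_integral_comp_mul_left (a := 0) (b := 1)
    (f := fun s => (t - s) ^ (α - 1) * h s) (c := t)
  simp only [mul_zero, mul_one] at h1
  rw [← h1, ← intervalIntegral.integral_const_mul, ← intervalIntegral.integral_const_mul]
  refine integral_congr fun x hx => ?_
  rw [uIcc_of_le zero_le_one] at hx
  have h2 : t - t * x = t * (1 - x) := by ring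
  have h3 : t ^ α = t * t ^ (α - 1) := by
    rw [rpow_sub_one ht.ne']; field_simp
  simp only [h2, mul_rpow ht.le (sub_nonneg.2 hx.2), h3]
  ring

theorem continuousOn_abel_integral {α M : ℝ} (hα : 0 < α) {h : ℝ → ℝ} (hh : Continuous h)
    (hM : ∀ s, |h s| ≤ M) :
    ContinuousOn (fun t => ∫ s in (0 : ℝ)..t, (t - s) ^ (α - 1) * h s) (Ici 0) := by
  have hker : IntervalIntegrable (fun x : ℝ => (1 - x) ^ (α - 1) * M) volume 0 1 :=
    intervalIntegrable_abel_kernel_mul hα continuousOn_const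
  have hcont : Continuous fun t : ℝ => ∫ x in (0 : ℝ)..1, (1 - x) ^ (α - 1) * h (t * x) := by
    refine intervalIntegral.continuous_of_dominated_interval
      (bound := fun x => (1 - x) ^ (α - 1) * M) (fun t => ?_) (fun t => ?_) hker ?_
    · exact (intervalIntegrable_abel_kernel_mul (t := 1) hα
        (h := fun x => h (t * x)) (by fun_prop)).def'.aestronglyMeasurable
    · refine .of_forall fun x hx => ?_
      rw [uIoc_of_le zero_le_one] at hx
      have h0 : 0 ≤ (1 - x) ^ (α - 1) := rpow_nonneg (sub_nonneg.2 hx.2) _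
      rw [norm_mul, norm_of_nonneg h0]
      exact mul_le_mul_of_nonneg_left (hM _) h0
    · exact .of_forall fun x _ => by fun_prop
  refine ContinuousOn.congr (f := fun t : ℝ => t ^ α *
    ∫ x in (0 : ℝ)..1, (1 - x) ^ (α - 1) * h (t * x)) ?_
    fun t ht => abel_integral_eq_rpow_mul hα ht h
  exact ((continuous_id.rpow_const fun _ => .inr hα.le).mul hcont).continuousOn

theorem abel_integral_exp_le {α β t : ℝ} (hα : 0 < α) (hβ : 0 < β) (ht : 0 ≤ t) :
    ∫ s in (0 : ℝ)..t, (t - s) ^ (α - 1) * exp (β * s) ≤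
      exp (β * t) * ((1 / β) ^ α * Gamma α) := by
  have h1 : ∫ s in (0 : ℝ)..t, (t - s) ^ (α - 1) * exp (β * s) =
      exp (β * t) * ∫ x in (0 : ℝ)..t, x ^ (α - 1) * exp (-(β * x)) := by
    have h2 := integral_comp_sub_left (a := 0) (b := t)
      (fun x => exp (β * t) * (x ^ (α - 1) * exp (-(β * x)))) t
    simp only [sub_self, sub_zero] at h2
    rw [← intervalIntegral.integral_const_mul, ← h2]
    refine integral_congr fun s _ => ?_
    have h3 : exp (β * s) = exp (β * t) * exp (-(β * (t - s))) := by
      rw [← exp_add]; congr 1; ring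
    simp only [h3]
    ring
  have h4 := integral_rpow_mul_exp_neg_mul_Ioi hα hβ
  rw [h1, ← h4, integral_of_le ht]
  refine mul_le_mul_of_nonneg_left ?_ (exp_pos _).le
  refine setIntegral_mono_set ?_ ?_ Ioc_subset_Ioi_self.eventuallyLE
  · refine Integrable.of_integral_ne_zero ?_
    rw [h4]
    exact (mul_pos (rpow_pos_of_pos (one_div_pos.2 hβ) _) (Gamma_pos_of_pos hα)).ne'
  · filter_upwards [ae_restrict_mem measurableSet_Ioi] with x hx
    exact mul_nonneg (rpow_nonneg (le_of_lt hx) _) (exp_pos _).le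

theorem abs_abel_integral_le {α β t K : ℝ} (hα : 0 < α) (hβ : 0 < β) (ht : 0 ≤ t)
    (hK : 0 ≤ K) {h : ℝ → ℝ} (hh : ∀ s ∈ Icc 0 t, |h s| ≤ K * exp (β * s)) :
    |∫ s in (0 : ℝ)..t, (t - s) ^ (α - 1) * h s| ≤
      K * (exp (β * t) * ((1 / β) ^ α * Gamma α)) := by
  rw [← Real.norm_eq_abs]
  refine le_trans (intervalIntegral.norm_integral_le_of_norm_le
    (g := fun s => K * ((t - s) ^ (α - 1) * exp (β * s))) ht ?_ ?_) ?_
  · refine .of_forall fun s hs => ?_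
    have h0 : 0 ≤ (t - s) ^ (α - 1) := rpow_nonneg (sub_nonneg.2 hs.2) _
    rw [norm_mul, norm_of_nonneg h0]
    calc _ ≤ (t - s) ^ (α - 1) * (K * exp (β * s)) :=
          mul_le_mul_of_nonneg_left (hh s ⟨hs.1.le, hs.2⟩) h0
      _ = _ := by ring
  · exact (intervalIntegrable_abel_kernel_mul hα (by fun_prop)).const_mul K
  · rw [intervalIntegral.integral_const_mul]
    exact mul_le_mul_of_nonneg_left (abel_integral_exp_le hα hβ ht) hK

/-- The Abel-Volterra equation with a Lipschitz nonlinearity has a unique continuous solution.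
The proof runs the contraction principle on the rescaled unknown `exp (-β t) * u t`. -/
theorem exists_unique_abel_volterra {α L S : ℝ} (c : ℝ) (hα : 0 < α) (hL : 0 < L) (hS : 0 ≤ S)
    {g : ℝ → ℝ → ℝ}
    (hg : ContinuousOn (fun p : ℝ × ℝ => g p.1 p.2) (Icc 0 S ×ˢ univ))
    (hLip : ∀ t ∈ Icc 0 S, ∀ x y, |g t x - g t y| ≤ L * |x - y|) :
    ∃ u : ℝ → ℝ, ContinuousOn u (Icc 0 S) ∧
      (∀ t ∈ Icc 0 S, u t = c + (1 / Gamma α) *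
        ∫ s in (0 : ℝ)..t, (t - s) ^ (α - 1) * g s (u s)) ∧
      ∀ v : ℝ → ℝ, ContinuousOn v (Icc 0 S) →
        (∀ t ∈ Icc 0 S, v t = c + (1 / Gamma α) *
          ∫ s in (0 : ℝ)..t, (t - s) ^ (α - 1) * g s (v s)) → EqOn u v (Icc 0 S) := by
  have hΓ : 0 < Gamma α := Gamma_pos_of_pos hα
  obtain ⟨β, hβ, hβL⟩ : ∃ β : ℝ, 0 < β ∧ L * (1 / β) ^ α = 1 / 2 := by
    refine ⟨(2 * L) ^ (1 / α), by positivity, ?_⟩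
    rw [one_div ((2 * L) ^ (1 / α)), inv_rpow (by positivity), ← rpow_mul (by positivity),
      one_div_mul_cancel hα.ne', rpow_one]
    field_simp
  -- The nonlinearity along the rescaled function, extended to the line by constants.
  let H : C(Icc 0 S, ℝ) → C(Icc 0 S, ℝ) := fun w =>
    ⟨fun s => g s (exp (β * s) * w s), by
      have h1 : Continuous fun s : Icc 0 S => ((s : ℝ), exp (β * s) * w s) := by fun_prop
      exact hg.comp_continuous h1 fun s => ⟨s.2, mem_univ _⟩⟩
  let h : C(Icc 0 S, ℝ) → ℝ → ℝ := fun w => IccExtend hS (H w)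
  have h_cont : ∀ w, Continuous (h w) := fun w => (H w).continuous.Icc_extend'
  have h_bdd : ∀ w s, |h w s| ≤ ‖H w‖ := fun w s => (H w).norm_coe_le_norm _
  have h_apply : ∀ w s (hs : s ∈ Icc 0 S), h w s = g s (exp (β * s) * w ⟨s, hs⟩) :=
    fun w s hs => IccExtend_of_mem hS (H w) hs
  let Φ : C(Icc 0 S, ℝ) → C(Icc 0 S, ℝ) := fun w =>
    ⟨fun t => exp (-(β * t)) * (c + (1 / Gamma α) *
      ∫ s in (0 : ℝ)..t, (t - s) ^ (α - 1) * h w s), by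
      have h1 : Continuous fun t : Icc 0 S =>
          ∫ s in (0 : ℝ)..t, ((t : ℝ) - s) ^ (α - 1) * h w s :=
        (continuousOn_abel_integral hα (h_cont w) (h_bdd w)).comp_continuous
          continuous_subtype_val fun t => t.2.1
      fun_prop⟩
  have hΦ : ContractingWith (1 / 2) Φ := by
    refine ⟨by norm_num, LipschitzWith.of_dist_le_mul fun w₁ w₂ => ?_⟩
    rw [ContinuousMap.dist_le (by positivity)]
    intro t
    have hint : ∀ w, IntervalIntegrable (fun s => ((t : ℝ) - s) ^ (α - 1) * h w s) volume 0 t :=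
      fun w => intervalIntegrable_abel_kernel_mul hα (h_cont w).continuousOn
    have h1 : Φ w₁ t - Φ w₂ t = exp (-(β * t)) * ((1 / Gamma α) *
        ∫ s in (0 : ℝ)..t, ((t : ℝ) - s) ^ (α - 1) * (h w₁ s - h w₂ s)) := by
      simp only [mul_sub]
      rw [intervalIntegral.integral_sub (hint w₁) (hint w₂)]
      simp only [Φ, ContinuousMap.coe_mk]
      ring
    have h2 : |∫ s in (0 : ℝ)..t, ((t : ℝ) - s) ^ (α - 1) * (h w₁ s - h w₂ s)| ≤
        (L * dist w₁ w₂) * (exp (β * t) * ((1 / β) ^ α * Gamma α)) := by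
      refine abs_abel_integral_le hα hβ t.2.1 (by positivity) fun s hs => ?_
      have hs' : s ∈ Icc 0 S := ⟨hs.1, hs.2.trans t.2.2⟩
      rw [h_apply _ s hs', h_apply _ s hs']
      refine (hLip s hs' _ _).trans ?_
      rw [← mul_sub, abs_mul, abs_of_pos (exp_pos _), mul_assoc, mul_comm (exp _)]
      gcongr
      exact ContinuousMap.dist_apply_le_dist (f := w₁) (g := w₂) ⟨s, hs'⟩
    rw [Real.dist_eq, h1, abs_mul, abs_mul, abs_of_pos (exp_pos _),
      abs_of_pos (one_div_pos.2 hΓ)]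
    calc _ ≤ exp (-(β * t)) * ((1 / Gamma α) *
          ((L * dist w₁ w₂) * (exp (β * t) * ((1 / β) ^ α * Gamma α)))) := by gcongr
      _ = (L * (1 / β) ^ α) * dist w₁ w₂ := by
        rw [exp_neg]; field_simp
      _ = _ := by rw [hβL]; norm_num
  have : Nonempty C(Icc 0 S, ℝ) := ⟨0⟩
  set w := hΦ.fixedPoint Φ
  have hfix : Φ w = w := hΦ.fixedPoint_isFixedPt
  have hexp : ∀ t x : ℝ, exp (β * t) * (exp (-(β * t)) * x) = x := fun t x => by
    rw [← mul_assoc, ← exp_add, add_neg_cancel, exp_zero, one_mul]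
  have hcongr : ∀ (w : C(Icc 0 S, ℝ)) (v : ℝ → ℝ),
      (∀ s (hs : s ∈ Icc 0 S), exp (β * s) * w ⟨s, hs⟩ = v s) → ∀ t ∈ Icc 0 S,
      ∫ s in (0 : ℝ)..t, (t - s) ^ (α - 1) * h w s =
        ∫ s in (0 : ℝ)..t, (t - s) ^ (α - 1) * g s (v s) := by
    intro w v hv t ht
    refine integral_congr fun s hs => ?_
    rw [uIcc_of_le ht.1] at hs
    have hs' : s ∈ Icc 0 S := ⟨hs.1, hs.2.trans ht.2⟩
    simp only [h_apply w s hs', hv s hs']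
  have hu : ∀ s (hs : s ∈ Icc 0 S),
      exp (β * s) * w ⟨s, hs⟩ = exp (β * s) * IccExtend hS w s := fun s hs => by
    rw [IccExtend_of_mem hS w hs]
  refine ⟨fun t => exp (β * t) * IccExtend hS w t, ?_, fun t ht => ?_, fun v hv hsol t ht => ?_⟩
  · have h1 : Continuous (IccExtend hS w) := w.continuous.Icc_extend'
    exact Continuous.continuousOn (by fun_prop)
  · beta_reduce
    rw [← hcongr w _ hu t ht, ← hexp t (c + _), ← hu t ht]
    exact congrArg (exp (β * t) * ·) (DFunLike.congr_fun hfix.symm ⟨t, ht⟩)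
  · let z : C(Icc 0 S, ℝ) := ⟨fun t => exp (-(β * t)) * v t, by
      have h1 : Continuous fun t : Icc 0 S => v t := continuousOn_iff_continuous_domRestrict.1 hv
      have h2 : Continuous fun t : Icc 0 S => exp (-(β * t)) := by fun_prop
      exact h2.mul h1⟩
    have hz : ∀ s (hs : s ∈ Icc 0 S), exp (β * s) * z ⟨s, hs⟩ = v s := fun s _ => hexp s (v s)
    have hzfix : Φ z = z := by
      ext t
      simp only [Φ, ContinuousMap.coe_mk]
      rw [hcongr z v hz t t.2, ← hsol t t.2]
      rfl
    have hzw : z = w := hΦ.fixedPoint_unique hzfix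
    simp only
    rw [← hu t ht, ← hzw, hz t ht]

theorem progressive_contractions_first_step
    (α r T L : ℝ) (hα0 : 0 < α) (hα1 : α < 1) (hr : 0 < r) (hT : 0 < T) (hL : 0 < L)
    (f : ℝ → ℝ → ℝ → ℝ) (φ : ℝ → ℝ)
    (hf : ContinuousOn (fun p : ℝ × ℝ × ℝ => f p.1 p.2.1 p.2.2)
      (Set.Icc 0 T ×ˢ (Set.univ : Set (ℝ × ℝ))))
    (hφ : ContinuousOn φ (Set.Icc (-r) 0))
    (hLip : ∀ t ∈ Set.Icc (0:ℝ) T, ∀ υ₁ υ₂ ϑ : ℝ,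
      |f t υ₁ ϑ - f t υ₂ ϑ| ≤ L * |υ₁ - υ₂|) :
    ∀ S : ℝ, 0 < S → S ≤ min r T →
      ∃ υ : ℝ → ℝ, SolvesConstDelayOn α r S f φ υ ∧
        ∀ υ' : ℝ → ℝ, SolvesConstDelayOn α r S f φ υ' → Set.EqOn υ υ' (Set.Icc (-r) S) := by
  intro S hS hSle
  have hSr : S ≤ r := hSle.trans (min_le_left _ _)
  have hST : S ≤ T := hSle.trans (min_le_right _ _)
  have hdelay : ∀ s ∈ Icc 0 S, s - r ∈ Icc (-r) 0 := fun s hs =>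
    ⟨by linarith [hs.1], by linarith [hs.2]⟩
  have hIcc : ∀ s ∈ Icc 0 S, s ∈ Icc 0 T := fun s hs => ⟨hs.1, hs.2.trans hST⟩
  obtain ⟨u, hu, husol, huniq⟩ := exists_unique_abel_volterra (g := fun s x => f s x (φ (s - r)))
    (φ 0) hα0 hL hS.le
    (by
      have h1 : ContinuousOn (fun p : ℝ × ℝ => φ (p.1 - r)) (Icc 0 S ×ˢ univ) :=
        hφ.comp (by fun_prop) fun p hp => hdelay _ hp.1
      exact hf.comp (f := fun p : ℝ × ℝ => (p.1, p.2, φ (p.1 - r)))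
        (continuousOn_fst.prodMk (continuousOn_snd.prodMk h1))
        fun p hp => ⟨hIcc _ hp.1, mem_univ _⟩)
    (fun t ht x y => hLip t (hIcc t ht) x y _)
  have hcongr : ∀ v w : ℝ → ℝ, (∀ s ∈ Icc (-r) 0, v s = φ s) → EqOn v w (Icc 0 S) →
      ∀ t ∈ Icc 0 S, ∫ s in (0 : ℝ)..t, (t - s) ^ (α - 1) * f s (v s) (v (s - r)) =
        ∫ s in (0 : ℝ)..t, (t - s) ^ (α - 1) * f s (w s) (φ (s - r)) := by
    intro v w hv hvw t ht
    refine integral_congr fun s hs => ?_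
    rw [uIcc_of_le ht.1] at hs
    have hs' : s ∈ Icc 0 S := ⟨hs.1, hs.2.trans ht.2⟩
    simp only [hvw hs', hv _ (hdelay s hs')]
  have hu0 : u 0 = φ 0 := by simpa using husol 0 ⟨le_rfl, hS.le⟩
  let υ : ℝ → ℝ := fun t => if t ≤ 0 then φ t else u t
  have hυφ : ∀ t ∈ Icc (-r) 0, υ t = φ t := fun t ht => if_pos ht.2
  have hυu : EqOn υ u (Icc 0 S) := fun t ht => by
    rcases ht.1.eq_or_lt with rfl | h0
    · simp [υ, hu0]
    · exact if_neg h0.not_ge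
  have hunion : Icc (-r) 0 ∪ Icc 0 S = Icc (-r) S := Icc_union_Icc_eq_Icc (by linarith) hS.le
  refine ⟨υ, ⟨?_, hυφ, fun t ht => ?_⟩, fun υ' ⟨hc, hinit, hsol⟩ => ?_⟩
  · rw [← hunion]
    exact (hφ.congr hυφ).union_of_isClosed (hu.congr hυu) isClosed_Icc isClosed_Icc
  · rw [hυu ht, hcongr υ u hυφ hυu t ht]
    exact husol t ht
  · rw [← hunion]
    refine EqOn.union (fun t ht => (hυφ t ht).trans (hinit t ht).symm)
      (hυu.trans (huniq υ' (hc.mono (Icc_subset_Icc_left (by linarith))) fun t ht => ?_))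
    rw [hsol t ht, hcongr υ' υ' hinit (eqOn_refl _ _) t ht]
end

section
/- Let (X,d) be a metric space equipped with a partial order ≤ that is closed (i.e., if xₙ → x and yₙ → y with xₙ ≤ yₙ for all n, then x ≤ y). Let A : X → X be monotone increasing (x ≤ y implies A(x) ≤ A(y)) and a Picard operator with unique fixed point x* (i.e., A(x*) = x* and the iterates Aⁿ(x₀) converge to x* for every x₀ ∈ X). Then for every x ∈ X: x ≤ A(x) implies x ≤ x*, and x ≥ A(x) implies x ≥ x*. -/
open Filter Topology

/-- Abstract Gronwall lemma of Rus: in a metric space with a closed partial order, an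
increasing Picard operator `A` with fixed point `xstar` satisfies:
`x ≤ A x → x ≤ xstar` and `A x ≤ x → xstar ≤ x`. -/
theorem abstract_gronwall_lemma
    {X : Type*} [MetricSpace X] [PartialOrder X]
    (hclosed : ∀ (x y : ℕ → X) (a b : X),
      Tendsto x atTop (𝓝 a) → Tendsto y atTop (𝓝 b) → (∀ n, x n ≤ y n) → a ≤ b)
    (A : X → X) (hmono : Monotone A)
    (xstar : X) (hfix : A xstar = xstar)
    (huniq : ∀ y : X, A y = y → y = xstar)
    (hconv : ∀ x₀ : X, Tendsto (fun n : ℕ => A^[n] x₀) atTop (𝓝 xstar)) :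
    ∀ x : X, (x ≤ A x → x ≤ xstar) ∧ (A x ≤ x → xstar ≤ x) := by
  refine fun x => ⟨fun hx => ?_, fun hx => ?_⟩
  · exact hclosed (fun _ => x) (fun n => A^[n] x) x xstar tendsto_const_nhds (hconv x)
      fun n => hmono.monotone_iterate_of_le_map hx n.zero_le
  · exact hclosed (fun n => A^[n] x) (fun _ => x) xstar x (hconv x) tendsto_const_nhds
      fun n => hmono.antitone_iterate_of_map_le hx n.zero_le
end
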